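/- Stability estimate for the dG(0) scheme (Theorem 4.1, case l = −1): There exists a constant C depending only on γ and ρ such that for every partition, every u_0, v_0 ∈ H, and all Bochner-integrable data f_1, f_2, the dG(0) approximation satisfies ‖U_{1,N}‖ + ‖A^{−1/2} U_{2,N}‖ ≤ C ( ‖u_0‖ + ‖A^{−1/2} v_0‖ + ∫_0^T ( ‖f_1(t)‖ + ‖A^{−1/2} f_2(t)‖ ) dt ). -/

import Mathlib

open MeasureTheory Finset
open scoped RealInnerProductSpace

/-- The time step `k_n = t_n − t_{n-1}`. -/
noncomputable def kstep (tp : ℕ → ℝ) (n : ℕ) : ℝ := tp n - tp (n - 1)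

/-- The quadrature weights
`ω_{n,j} = ∫_{I_n} ∫_{t_{j-1}}^{min(t_j, t)} β(t − s) ds dt` for `1 ≤ j ≤ n ≤ N`. -/
noncomputable def qweight (β : ℝ → ℝ) (tp : ℕ → ℝ) (n j : ℕ) : ℝ :=
  ∫ t in (tp (n - 1))..(tp n), ∫ s in (tp (j - 1))..(min (tp j) t), β (t - s)

/-- The interval averages of the data, `f̄_n = (1/k_n) ∫_{I_n} f(t) dt`. -/
noncomputable def iavg {H : Type*} [NormedAddCommGroup H] [NormedSpace ℝ H]
    (tp : ℕ → ℝ) (f : ℝ → H) (n : ℕ) : H :=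
  (kstep tp n)⁻¹ • ∫ t in (tp (n - 1))..(tp n), f t

section Weights

/-- The primitive `∫_0^x β`, extended by zero to `x ≤ 0`. -/
noncomputable def kernelPrimitive (β : ℝ → ℝ) (x : ℝ) : ℝ :=
  ∫ r in (0:ℝ)..x, (Set.Ioi (0:ℝ)).indicator β r

/-- The mass `∫_{I_j} β(t − s) ds` seen from time `t` for `j ≥ 1`; for `j = 0` the mass of the
history before time `0`. -/
noncomputable def kernelMass (β : ℝ → ℝ) (γ : ℝ) (tp : ℕ → ℝ) : ℕ → ℝ → ℝ
  | 0, t => γ - kernelPrimitive β t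
  | j + 1, t => kernelPrimitive β (t - tp j) - kernelPrimitive β (t - tp (j + 1))

/-- The averages of `kernelMass` over the interval `(t_n, t_{n+1})`. -/
noncomputable def meanWeight (β : ℝ → ℝ) (γ : ℝ) (tp : ℕ → ℝ) (n j : ℕ) : ℝ :=
  (tp (n + 1) - tp n)⁻¹ * ∫ t in (tp n)..(tp (n + 1)), kernelMass β γ tp j t

variable {β : ℝ → ℝ} {γ : ℝ} {tp : ℕ → ℝ}

theorem intervalIntegrable_indicator_Ioi (hi : IntegrableOn β (Set.Ioi 0)) (a b : ℝ) :
    IntervalIntegrable ((Set.Ioi (0:ℝ)).indicator β) volume a b :=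
  (hi.integrable_indicator measurableSet_Ioi).intervalIntegrable

theorem indicator_Ioi_nonneg (h0 : ∀ s ∈ Set.Ioi (0:ℝ), 0 ≤ β s) (r : ℝ) :
    0 ≤ (Set.Ioi (0:ℝ)).indicator β r :=
  Set.indicator_nonneg h0 r

theorem kernelPrimitive_sub (hi : IntegrableOn β (Set.Ioi 0)) (x y : ℝ) :
    kernelPrimitive β y - kernelPrimitive β x
      = ∫ r in x..y, (Set.Ioi (0:ℝ)).indicator β r :=
  intervalIntegral.integral_interval_sub_left (intervalIntegrable_indicator_Ioi hi _ _)
    (intervalIntegrable_indicator_Ioi hi _ _)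

theorem continuous_kernelPrimitive (hi : IntegrableOn β (Set.Ioi 0)) :
    Continuous (kernelPrimitive β) :=
  intervalIntegral.continuous_primitive (intervalIntegrable_indicator_Ioi hi) 0

theorem kernelPrimitive_mono (h0 : ∀ s ∈ Set.Ioi (0:ℝ), 0 ≤ β s)
    (hi : IntegrableOn β (Set.Ioi 0)) : Monotone (kernelPrimitive β) := by
  intro x y hxy
  rw [← sub_nonneg, kernelPrimitive_sub hi]
  exact intervalIntegral.integral_nonneg hxy fun r _ => indicator_Ioi_nonneg h0 r

theorem kernelPrimitive_of_nonpos {x : ℝ} (hx : x ≤ 0) : kernelPrimitive β x = 0 := by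
  rw [kernelPrimitive]
  refine intervalIntegral.integral_zero_ae (Filter.Eventually.of_forall fun r hr => ?_)
  rw [Set.uIoc_of_ge hx] at hr
  exact Set.indicator_of_notMem (by simpa using hr.2) _

theorem kernelPrimitive_le (h0 : ∀ s ∈ Set.Ioi (0:ℝ), 0 ≤ β s)
    (hi : IntegrableOn β (Set.Ioi 0)) (hγ : ∫ s in Set.Ioi (0:ℝ), β s = γ) (x : ℝ) :
    kernelPrimitive β x ≤ γ := by
  have h : ∀ y, 0 ≤ y → kernelPrimitive β y ≤ γ := by
    intro y hy
    rw [kernelPrimitive, intervalIntegral.integral_of_le hy, ← hγ,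
      ← integral_indicator measurableSet_Ioi]
    exact setIntegral_le_integral (hi.integrable_indicator measurableSet_Ioi)
      (Filter.Eventually.of_forall fun r => indicator_Ioi_nonneg h0 r)
  exact (kernelPrimitive_mono h0 hi (le_max_left x 0)).trans (h _ (le_max_right x 0))

theorem antitoneOn_kernelPrimitive_sub (hβ : AntitoneOn β (Set.Ioi 0))
    (hi : IntegrableOn β (Set.Ioi 0)) {a b : ℝ} (hab : a ≤ b) :
    AntitoneOn (fun t => kernelPrimitive β (t - a) - kernelPrimitive β (t - b)) (Set.Ici b) := by
  intro t ht t' ht' htt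
  have ht : b ≤ t := ht
  simp only [kernelPrimitive_sub hi]
  rw [← intervalIntegral.integral_comp_sub_left, ← intervalIntegral.integral_comp_sub_left]
  have hint : ∀ r : ℝ,
      IntervalIntegrable (fun s => (Set.Ioi (0:ℝ)).indicator β (r - s)) volume a b :=
    fun r => ((hi.integrable_indicator measurableSet_Ioi).comp_sub_left r).intervalIntegrable
  refine intervalIntegral.integral_mono_on_of_le_Ioo hab (hint _) (hint _) fun s hs => ?_
  have h1 : t - s ∈ Set.Ioi (0:ℝ) := by simp only [Set.mem_Ioi]; linarith [hs.2]
  have h2 : t' - s ∈ Set.Ioi (0:ℝ) := by simp only [Set.mem_Ioi]; linarith [hs.2]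
  rw [Set.indicator_of_mem h1, Set.indicator_of_mem h2]
  exact hβ h1 h2 (by linarith)

theorem continuous_kernelMass (hi : IntegrableOn β (Set.Ioi 0)) (j : ℕ) :
    Continuous (kernelMass β γ tp j) := by
  have h := continuous_kernelPrimitive hi
  cases j with
  | zero => exact continuous_const.sub h
  | succ j => exact (h.comp (continuous_sub_right _)).sub (h.comp (continuous_sub_right _))

theorem kernelMass_nonneg (h0 : ∀ s ∈ Set.Ioi (0:ℝ), 0 ≤ β s)
    (hi : IntegrableOn β (Set.Ioi 0)) (hγ : ∫ s in Set.Ioi (0:ℝ), β s = γ)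
    (htp : Monotone tp) (j : ℕ) (t : ℝ) : 0 ≤ kernelMass β γ tp j t := by
  cases j with
  | zero => exact sub_nonneg.2 (kernelPrimitive_le h0 hi hγ t)
  | succ j =>
    exact sub_nonneg.2 (kernelPrimitive_mono h0 hi (by linarith [htp (Nat.le_succ j)]))

theorem antitoneOn_kernelMass (h0 : ∀ s ∈ Set.Ioi (0:ℝ), 0 ≤ β s)
    (hβ : AntitoneOn β (Set.Ioi 0)) (hi : IntegrableOn β (Set.Ioi 0))
    (htp : Monotone tp) (j : ℕ) : AntitoneOn (kernelMass β γ tp j) (Set.Ici (tp j)) := by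
  cases j with
  | zero => exact fun x _ y _ hxy => sub_le_sub_left (kernelPrimitive_mono h0 hi hxy) γ
  | succ j => exact antitoneOn_kernelPrimitive_sub hβ hi (htp (Nat.le_succ j))

theorem sum_kernelMass (htp0 : tp 0 = 0) {n : ℕ} {t : ℝ} (ht : t ≤ tp n) :
    ∑ j ∈ range (n + 1), kernelMass β γ tp j t = γ := by
  rw [sum_range_succ']
  simp only [kernelMass]
  rw [sum_range_sub' (fun j => kernelPrimitive β (t - tp j)), htp0,
    kernelPrimitive_of_nonpos (sub_nonpos.2 ht)]
  simp

theorem meanWeight_nonneg (h0 : ∀ s ∈ Set.Ioi (0:ℝ), 0 ≤ β s)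
    (hi : IntegrableOn β (Set.Ioi 0)) (hγ : ∫ s in Set.Ioi (0:ℝ), β s = γ)
    (htp : Monotone tp) (n j : ℕ) : 0 ≤ meanWeight β γ tp n j :=
  mul_nonneg (inv_nonneg.2 (sub_nonneg.2 (htp (Nat.le_succ n))))
    (intervalIntegral.integral_nonneg (htp (Nat.le_succ n))
      fun t _ => kernelMass_nonneg h0 hi hγ htp j t)

theorem meanWeight_succ_le (h0 : ∀ s ∈ Set.Ioi (0:ℝ), 0 ≤ β s)
    (hβ : AntitoneOn β (Set.Ioi 0)) (hi : IntegrableOn β (Set.Ioi 0))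
    (htp : StrictMono tp) {n j : ℕ} (hj : j ≤ n) :
    meanWeight β γ tp (n + 1) j ≤ meanWeight β γ tp n j := by
  have hanti := antitoneOn_kernelMass (γ := γ) h0 hβ hi htp.monotone j
  have hcont := continuous_kernelMass (γ := γ) (tp := tp) hi j
  have hjn := htp.monotone hj
  have h1 := htp (Nat.lt_succ_self n)
  have h2 := htp (Nat.lt_succ_self (n + 1))
  simp only [Nat.succ_eq_add_one] at h1 h2
  trans kernelMass β γ tp j (tp (n + 1))
  · rw [meanWeight, inv_mul_le_iff₀ (sub_pos.2 h2), ← smul_eq_mul,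
      ← intervalIntegral.integral_const]
    refine intervalIntegral.integral_mono_on h2.le (hcont.intervalIntegrable _ _)
      intervalIntegrable_const fun t ht => ?_
    exact hanti (Set.mem_Ici.2 (by linarith)) (Set.mem_Ici.2 (by linarith [ht.1])) ht.1
  · rw [meanWeight, le_inv_mul_iff₀ (sub_pos.2 h1), ← smul_eq_mul,
      ← intervalIntegral.integral_const]
    refine intervalIntegral.integral_mono_on h1.le intervalIntegrable_const
      (hcont.intervalIntegrable _ _) fun t ht => ?_
    exact hanti (Set.mem_Ici.2 (by linarith [ht.1])) (Set.mem_Ici.2 (by linarith)) ht.2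

theorem sum_meanWeight (hi : IntegrableOn β (Set.Ioi 0)) (htp0 : tp 0 = 0) (htp : StrictMono tp)
    (n : ℕ) : ∑ j ∈ range (n + 2), meanWeight β γ tp n j = γ := by
  have h1 : tp n < tp (n + 1) := htp (Nat.lt_succ_self n)
  simp only [meanWeight]
  rw [← mul_sum, ← intervalIntegral.integral_finsetSum
    fun j _ => (continuous_kernelMass hi j).intervalIntegrable _ _]
  rw [intervalIntegral.integral_congr (g := fun _ => γ)]
  · rw [intervalIntegral.integral_const, smul_eq_mul, inv_mul_cancel_left₀ (sub_pos.2 h1).ne']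
  · intro t ht
    rw [Set.uIcc_of_le h1.le] at ht
    exact sum_kernelMass htp0 ht.2

theorem qweight_eq_meanWeight (hi : IntegrableOn β (Set.Ioi 0)) (htp : StrictMono tp)
    {n j : ℕ} (hj : j ≤ n) :
    qweight β tp (n + 1) (j + 1) = (tp (n + 1) - tp n) * meanWeight β γ tp n (j + 1) := by
  have h1 : tp n < tp (n + 1) := htp (Nat.lt_succ_self n)
  rw [meanWeight, mul_inv_cancel_left₀ (sub_pos.2 h1).ne', qweight]
  simp only [Nat.add_sub_cancel]
  refine intervalIntegral.integral_congr fun t ht => ?_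
  rw [Set.uIcc_of_le h1.le] at ht
  have hjt : tp j ≤ t := (htp.monotone hj).trans ht.1
  have hjm : tp j ≤ min (tp (j + 1)) t := le_min (htp.monotone (Nat.le_succ j)) hjt
  have key : kernelPrimitive β (t - min (tp (j + 1)) t) = kernelPrimitive β (t - tp (j + 1)) := by
    rcases le_total (tp (j + 1)) t with h | h
    · rw [min_eq_left h]
    · rw [min_eq_right h, kernelPrimitive_of_nonpos (by linarith),
        kernelPrimitive_of_nonpos (by linarith)]
  simp only [kernelMass]
  rw [intervalIntegral.integral_comp_sub_left, ← key, kernelPrimitive_sub hi]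
  refine intervalIntegral.integral_congr_ae (Filter.Eventually.of_forall fun r hr => ?_)
  rw [Set.uIoc_of_le (by linarith)] at hr
  have hr0 : r ∈ Set.Ioi (0:ℝ) := (sub_nonneg.2 (min_le_right _ _)).trans_lt hr.1
  rw [Set.indicator_of_mem hr0]

end Weights

section Energy

variable {H : Type*} [NormedAddCommGroup H] [InnerProductSpace ℝ H]

theorem half_norm_sq_sub_le_inner (x y : H) :
    (‖x‖ ^ 2 - ‖y‖ ^ 2) / 2 ≤ ⟪x, x - y⟫ := by
  have := norm_sub_sq_real x y
  rw [inner_sub_right, real_inner_self_eq_norm_sq]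
  nlinarith [sq_nonneg ‖x - y‖]

/-- Discrete positivity of the memory term, for weights nonincreasing in time. -/
theorem half_sum_memory_le {B : ℕ → ℕ → ℝ} (hB0 : ∀ n j, 0 ≤ B n j)
    (hB : ∀ n j, j ≤ n → B (n + 1) j ≤ B n j) (u : ℕ → H) (M : ℕ) :
    (∑ j ∈ range (M + 1), B M j * ‖u M - u j‖ ^ 2) / 2
      ≤ ∑ n ∈ range M, ∑ j ∈ range (n + 1), B n j * ⟪u (n + 1) - u j, u (n + 1) - u n⟫ := by
  induction M with
  | zero => simp
  | succ M ih =>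
    rw [sum_range_succ _ M, sum_range_succ _ (M + 1)]
    have h : (∑ j ∈ range (M + 1), B (M + 1) j * ‖u (M + 1) - u j‖ ^ 2) / 2
        ≤ (∑ j ∈ range (M + 1), B M j * ‖u M - u j‖ ^ 2) / 2
          + ∑ j ∈ range (M + 1), B M j * ⟪u (M + 1) - u j, u (M + 1) - u M⟫ := by
      rw [sum_div, sum_div, ← sum_add_distrib]
      refine sum_le_sum fun j hj => ?_
      have hjM : j ≤ M := Nat.lt_succ_iff.1 (mem_range.1 hj)
      have h1 := half_norm_sq_sub_le_inner (u (M + 1) - u j) (u M - u j)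
      rw [sub_sub_sub_cancel_right] at h1
      have h2 := mul_le_mul_of_nonneg_left h1 (hB0 M j)
      have h3 := mul_le_mul_of_nonneg_right (hB M j hjM) (sq_nonneg ‖u (M + 1) - u j‖)
      linarith
    simp only [sub_self, norm_zero]
    linarith

theorem norm_sum_antitone_smul_sub_le {c : ℕ → ℝ} (hc0 : ∀ n, 0 ≤ c n)
    (hc : ∀ n, c (n + 1) ≤ c n) {u : ℕ → H} {Z : ℝ} {M : ℕ} (hu : ∀ n ≤ M, ‖u n‖ ≤ Z) :
    ‖∑ n ∈ range M, c n • (u (n + 1) - u n)‖ ≤ 2 * c 0 * Z := by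
  have hZ : 0 ≤ Z := (norm_nonneg _).trans (hu 0 (Nat.zero_le M))
  have key : ∀ m ≤ M,
      ‖∑ n ∈ range m, c n • (u (n + 1) - u n) - c m • u m‖ ≤ (2 * c 0 - c m) * Z := by
    intro m
    induction m with
    | zero =>
      intro _
      have := mul_le_mul_of_nonneg_left (hu 0 (Nat.zero_le M)) (hc0 0)
      simp only [range_zero, sum_empty, zero_sub, norm_neg, norm_smul, Real.norm_eq_abs,
        abs_of_nonneg (hc0 0)]
      linarith
    | succ m ih =>
      intro hm
      have e : ∑ n ∈ range (m + 1), c n • (u (n + 1) - u n) - c (m + 1) • u (m + 1)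
          = (∑ n ∈ range m, c n • (u (n + 1) - u n) - c m • u m)
            + (c m - c (m + 1)) • u (m + 1) := by
        rw [sum_range_succ]; module
      have h0 : 0 ≤ c m - c (m + 1) := sub_nonneg.2 (hc m)
      have h1 := mul_le_mul_of_nonneg_left (hu (m + 1) hm) h0
      rw [e]
      refine (norm_add_le _ _).trans ?_
      rw [norm_smul, Real.norm_eq_abs, abs_of_nonneg h0]
      linarith [ih (by omega)]
  have h1 := norm_le_norm_sub_add (∑ n ∈ range M, c n • (u (n + 1) - u n)) (c M • u M)
  have h2 := mul_le_mul_of_nonneg_left (hu M le_rfl) (hc0 M)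
  rw [norm_smul, Real.norm_eq_abs, abs_of_nonneg (hc0 M)] at h1
  linarith [key M le_rfl]

/-- The discrete memory operator `u_{n+1} − Σ_{1 ≤ j ≤ n+1} B_{n,j} u_j`. -/
def memoryTerm (B : ℕ → ℕ → ℝ) (u : ℕ → H) (n : ℕ) : H :=
  u (n + 1) - ∑ j ∈ range (n + 1), B n (j + 1) • u (j + 1)

theorem memoryTerm_eq {B : ℕ → ℕ → ℝ} {γ : ℝ} {n : ℕ}
    (hsum : ∑ j ∈ range (n + 2), B n j = γ) (u : ℕ → H) :
    memoryTerm B u n = (1 - γ) • u (n + 1)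
      + ∑ j ∈ range (n + 1), B n j • (u (n + 1) - u j) + B n 0 • u 0 := by
  have h1 : ∑ j ∈ range (n + 2), B n j • (u (n + 1) - u j)
      = ∑ j ∈ range (n + 1), B n j • (u (n + 1) - u j) := by
    rw [sum_range_succ _ (n + 1)]; simp
  have h2 : ∑ j ∈ range (n + 2), B n j • (u (n + 1) - u j)
      = γ • u (n + 1)
        - (∑ j ∈ range (n + 1), B n (j + 1) • u (j + 1) + B n 0 • u 0) := by
    rw [← sum_range_succ' (fun j => B n j • u j), ← hsum, sum_smul, ← sum_sub_distrib]
    simp only [smul_sub]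
  rw [← h1, h2, memoryTerm]
  module

theorem norm_memoryTerm_le {B : ℕ → ℕ → ℝ} (hB0 : ∀ n j, 0 ≤ B n j) {γ : ℝ} (hγ : γ ≤ 1)
    {u : ℕ → H} {Z : ℝ} {n : ℕ} (hsum : ∑ j ∈ range (n + 2), B n j = γ)
    (hu : ∀ j ≤ n + 1, ‖u j‖ ≤ Z) : ‖memoryTerm B u n‖ ≤ 2 * Z := by
  have hZ : 0 ≤ Z := (norm_nonneg _).trans (hu 0 (Nat.zero_le _))
  have h1 : ‖∑ j ∈ range (n + 1), B n (j + 1) • u (j + 1)‖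
      ≤ (∑ j ∈ range (n + 1), B n (j + 1)) * Z := by
    rw [sum_mul]
    refine norm_sum_le_of_le _ fun j hj => ?_
    rw [norm_smul, Real.norm_eq_abs, abs_of_nonneg (hB0 _ _)]
    exact mul_le_mul_of_nonneg_left (hu _ (by have := mem_range.1 hj; omega)) (hB0 _ _)
  have h2 : ∑ j ∈ range (n + 1), B n (j + 1) ≤ 1 := by
    rw [sum_range_succ'] at hsum
    linarith [hB0 n 0]
  have h3 := mul_le_mul_of_nonneg_right h2 hZ
  refine (norm_sub_le _ _).trans ?_
  linarith [hu (n + 1) le_rfl]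

theorem energy_le {B : ℕ → ℕ → ℝ} (hB0 : ∀ n j, 0 ≤ B n j)
    (hB : ∀ n j, j ≤ n → B (n + 1) j ≤ B n j) {γ ρ : ℝ} (hγ1 : γ ≤ 1) (hρ : 0 ≤ ρ)
    (hsum : ∀ n, ∑ j ∈ range (n + 2), B n j = γ) {u w F G : ℕ → H} {Z : ℝ} {M : ℕ}
    (hu : ∀ n ≤ M, ‖u n‖ ≤ Z) (hw : ∀ n ≤ M, ‖w n‖ ≤ Z)
    (h : ∀ n < M, ρ * ⟪w (n + 1), w (n + 1) - w n⟫
      + ⟪memoryTerm B u n, u (n + 1) - u n - F n⟫ = ⟪G n, w (n + 1)⟫) :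
    ρ / 2 * ‖w M‖ ^ 2 + (1 - γ) / 2 * ‖u M‖ ^ 2
      ≤ ρ / 2 * ‖w 0‖ ^ 2 + (1 - γ) / 2 * ‖u 0‖ ^ 2 + 2 * ‖u 0‖ * Z
        + ∑ n ∈ range M, (2 * Z * ‖F n‖ + Z * ‖G n‖) := by
  have step : ∀ n ∈ range M,
      (ρ / 2 * (‖w (n + 1)‖ ^ 2 - ‖w n‖ ^ 2) + (1 - γ) / 2 * (‖u (n + 1)‖ ^ 2 - ‖u n‖ ^ 2))
        + ∑ j ∈ range (n + 1), B n j * ⟪u (n + 1) - u j, u (n + 1) - u n⟫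
        + ⟪u 0, B n 0 • (u (n + 1) - u n)⟫
      ≤ 2 * Z * ‖F n‖ + Z * ‖G n‖ := by
    intro n hn
    have hnM := mem_range.1 hn
    have e := h n hnM
    have hm : ⟪memoryTerm B u n, F n⟫ ≤ 2 * Z * ‖F n‖ :=
      (real_inner_le_norm _ _).trans (mul_le_mul_of_nonneg_right
        (norm_memoryTerm_le hB0 hγ1 (hsum n) fun j hj => hu j (by omega)) (norm_nonneg _))
    have hg : ⟪G n, w (n + 1)⟫ ≤ Z * ‖G n‖ := by
      have := mul_le_mul_of_nonneg_left (hw (n + 1) hnM) (norm_nonneg (G n))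
      linarith [real_inner_le_norm (G n) (w (n + 1))]
    have hww := mul_le_mul_of_nonneg_left (half_norm_sq_sub_le_inner (w (n + 1)) (w n)) hρ
    have huu := mul_le_mul_of_nonneg_left (half_norm_sq_sub_le_inner (u (n + 1)) (u n))
      (sub_nonneg.2 hγ1)
    have hexp : ⟪memoryTerm B u n, u (n + 1) - u n⟫
        = (1 - γ) * ⟪u (n + 1), u (n + 1) - u n⟫
          + ∑ j ∈ range (n + 1), B n j * ⟪u (n + 1) - u j, u (n + 1) - u n⟫
          + ⟪u 0, B n 0 • (u (n + 1) - u n)⟫ := by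
      rw [memoryTerm_eq (hsum n), inner_add_left, inner_add_left, sum_inner,
        real_inner_smul_left, real_inner_smul_left, real_inner_smul_right]
      simp only [real_inner_smul_left]
    rw [inner_sub_right (memoryTerm B u n), hexp] at e
    linarith
  have tot := sum_le_sum step
  rw [sum_add_distrib, sum_add_distrib, sum_add_distrib, ← mul_sum, ← mul_sum,
    sum_range_sub (fun n => ‖w n‖ ^ 2), sum_range_sub (fun n => ‖u n‖ ^ 2), ← inner_sum] at tot
  have hmem : 0 ≤ ∑ n ∈ range M, ∑ j ∈ range (n + 1),
      B n j * ⟪u (n + 1) - u j, u (n + 1) - u n⟫ :=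
    le_trans (div_nonneg (sum_nonneg fun j _ => mul_nonneg (hB0 _ _) (sq_nonneg _)) (by norm_num))
      (half_sum_memory_le hB0 hB u M)
  have hZ : 0 ≤ Z := (norm_nonneg _).trans (hu 0 (Nat.zero_le M))
  have hB00 : B 0 0 ≤ 1 := by
    have := hsum 0
    simp only [sum_range_succ, range_zero, sum_empty] at this
    linarith [hB0 0 1]
  have habel : ‖∑ n ∈ range M, B n 0 • (u (n + 1) - u n)‖ ≤ 2 * Z :=
    (norm_sum_antitone_smul_sub_le (fun n => hB0 n 0) (fun n => hB n 0 (Nat.zero_le n)) hu).trans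
      (by nlinarith)
  have hin := (abs_le.1 (abs_real_inner_le_norm (u 0)
    (∑ n ∈ range M, B n 0 • (u (n + 1) - u n)))).1
  have := mul_le_mul_of_nonneg_left habel (norm_nonneg (u 0))
  linarith

/-- The stability constant, for the sum of the norms of the two components. -/
noncomputable def stabilityConst (γ ρ : ℝ) : ℝ := (ρ / 2 + 5) / (min ρ (1 - γ) / 4)

theorem stabilityConst_pos {γ ρ : ℝ} (hγ : γ < 1) (hρ : 0 < ρ) : 0 < stabilityConst γ ρ := by
  have : 0 < min ρ (1 - γ) := lt_min hρ (sub_pos.2 hγ)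
  unfold stabilityConst
  positivity

theorem norm_add_norm_le_stabilityConst {B : ℕ → ℕ → ℝ} (hB0 : ∀ n j, 0 ≤ B n j)
    (hB : ∀ n j, j ≤ n → B (n + 1) j ≤ B n j) {γ ρ : ℝ} (hγ0 : 0 ≤ γ) (hγ1 : γ < 1) (hρ : 0 < ρ)
    (hsum : ∀ n, ∑ j ∈ range (n + 2), B n j = γ) {u w F G : ℕ → H} {N : ℕ}
    (h : ∀ n < N, ρ * ⟪w (n + 1), w (n + 1) - w n⟫
      + ⟪memoryTerm B u n, u (n + 1) - u n - F n⟫ = ⟪G n, w (n + 1)⟫) :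
    ‖u N‖ + ‖w N‖
      ≤ stabilityConst γ ρ * (‖u 0‖ + ‖w 0‖ + ∑ n ∈ range N, (‖F n‖ + ‖G n‖)) := by
  obtain ⟨M, hM, hmax⟩ := exists_max_image (range (N + 1)) (fun n => ‖u n‖ + ‖w n‖)
    ⟨0, by simp⟩
  simp only [mem_range, Nat.lt_succ_iff] at hM hmax
  refine (hmax N le_rfl).trans ?_
  set Z := ‖u M‖ + ‖w M‖ with hZ
  set D := ∑ n ∈ range N, (‖F n‖ + ‖G n‖) with hD
  have hu : ∀ n ≤ M, ‖u n‖ ≤ Z := fun n hn => by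
    linarith [hmax n (by omega), norm_nonneg (w n)]
  have hw : ∀ n ≤ M, ‖w n‖ ≤ Z := fun n hn => by
    linarith [hmax n (by omega), norm_nonneg (u n)]
  have hE := energy_le hB0 hB hγ1.le hρ.le hsum hu hw fun n hn => h n (by omega)
  have hZ0 : 0 ≤ Z := by positivity
  have hα : 0 < min ρ (1 - γ) := lt_min hρ (sub_pos.2 hγ1)
  have hD0 : 0 ≤ D := sum_nonneg fun n _ => by positivity
  have hdata : ∑ n ∈ range M, (2 * Z * ‖F n‖ + Z * ‖G n‖) ≤ 2 * Z * D := by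
    rw [hD, mul_sum]
    refine (sum_le_sum_of_subset_of_nonneg (range_mono hM) fun n _ _ => by positivity).trans
      (sum_le_sum fun n _ => ?_)
    nlinarith [mul_nonneg hZ0 (norm_nonneg (G n))]
  have h1 : ρ / 2 * ‖w 0‖ ^ 2 ≤ ρ / 2 * (Z * ‖w 0‖) := by
    have := mul_le_mul_of_nonneg_right (hw 0 (Nat.zero_le M)) (norm_nonneg (w 0))
    rw [sq]; exact mul_le_mul_of_nonneg_left this (by positivity)
  have h2 : (1 - γ) / 2 * ‖u 0‖ ^ 2 ≤ 1 * (Z * ‖u 0‖) := by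
    have := mul_le_mul_of_nonneg_right (hu 0 (Nat.zero_le M)) (norm_nonneg (u 0))
    rw [sq]
    exact mul_le_mul (by linarith) this (by positivity) (by norm_num)
  have h3 : min ρ (1 - γ) / 4 * Z ^ 2 ≤ ρ / 2 * ‖w M‖ ^ 2 + (1 - γ) / 2 * ‖u M‖ ^ 2 := by
    have e1 := mul_le_mul_of_nonneg_right (min_le_left ρ (1 - γ)) (sq_nonneg ‖w M‖)
    have e2 := mul_le_mul_of_nonneg_right (min_le_right ρ (1 - γ)) (sq_nonneg ‖u M‖)
    have e3 : Z ^ 2 ≤ 2 * (‖w M‖ ^ 2 + ‖u M‖ ^ 2) := by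
      rw [hZ]; nlinarith [sq_nonneg (‖u M‖ - ‖w M‖)]
    have e4 := mul_le_mul_of_nonneg_left e3 hα.le
    linarith
  have h4 : min ρ (1 - γ) / 4 * Z ^ 2 ≤ (ρ / 2 + 5) * (‖u 0‖ + ‖w 0‖ + D) * Z := by
    have p1 := mul_nonneg hZ0 (norm_nonneg (u 0))
    have p2 := mul_nonneg hZ0 (norm_nonneg (w 0))
    have p3 := mul_nonneg hZ0 hD0
    have q1 := mul_nonneg hρ.le p1
    have q3 := mul_nonneg hρ.le p3
    nlinarith
  rw [stabilityConst, div_mul_eq_mul_div, le_div_iff₀ (by positivity)]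
  rcases hZ0.eq_or_lt with h0 | h0
  · rw [← h0, zero_mul]; positivity
  · refine le_of_mul_le_mul_right ?_ h0
    linarith

end Energy

section Scheme

/-- A partition indexed by `0, …, N` extends to a strictly increasing sequence. -/
theorem exists_strictMono_extension {N : ℕ} {tp : ℕ → ℝ} (h : ∀ n < N, tp n < tp (n + 1)) :
    ∃ τ : ℕ → ℝ, StrictMono τ ∧ ∀ n ≤ N, τ n = tp n := by
  refine ⟨fun n => if n ≤ N then tp n else tp N + (n - N), strictMono_nat_of_lt_succ fun n => ?_,
    fun n hn => if_pos hn⟩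
  rcases lt_trichotomy n N with hn | rfl | hn
  · simpa [hn.le, Nat.succ_le_of_lt hn] using h n hn
  · simp
  · simp [show ¬ n ≤ N by omega, show ¬ n + 1 ≤ N by omega]

variable {H : Type*} [NormedAddCommGroup H]

theorem kstep_smul_iavg [NormedSpace ℝ H] {tp : ℕ → ℝ} {n : ℕ} (h : tp n < tp (n + 1))
    (f : ℝ → H) :
    kstep tp (n + 1) • iavg tp f (n + 1) = ∫ t in (tp n)..(tp (n + 1)), f t := by
  have hk : kstep tp (n + 1) ≠ 0 := (sub_pos.2 h).ne'
  rw [iavg, smul_inv_smul₀ hk, Nat.add_sub_cancel]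

theorem sum_norm_integral_le [NormedSpace ℝ H] {N : ℕ} {tp : ℕ → ℝ} (htp0 : tp 0 = 0)
    (htp : ∀ n < N, tp n < tp (n + 1)) {f g : ℝ → H}
    (hf : ∀ n < N, IntervalIntegrable f volume (tp n) (tp (n + 1)))
    (hg : ∀ n < N, IntervalIntegrable g volume (tp n) (tp (n + 1))) :
    ∑ n ∈ range N, (‖∫ t in (tp n)..(tp (n + 1)), f t‖ + ‖∫ t in (tp n)..(tp (n + 1)), g t‖)
      ≤ ∫ t in (0:ℝ)..(tp N), (‖f t‖ + ‖g t‖) := by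
  rw [← htp0, ← intervalIntegral.sum_integral_adjacent_intervals
    fun n hn => (hf n hn).norm.add (hg n hn).norm]
  refine sum_le_sum fun n hn => ?_
  have hn := mem_range.1 hn
  rw [intervalIntegral.integral_add (hf n hn).norm (hg n hn).norm]
  exact add_le_add (intervalIntegral.norm_integral_le_integral_norm (htp n hn).le)
    (intervalIntegral.norm_integral_le_integral_norm (htp n hn).le)

variable [InnerProductSpace ℝ H]

theorem smul_map_memoryTerm (L : H →L[ℝ] H) (B : ℕ → ℕ → ℝ) (u : ℕ → H) (n : ℕ) (k : ℝ) :
    k • L (memoryTerm B u n) = (k - k * B n (n + 1)) • L (u (n + 1))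
      - ∑ j ∈ Ico 1 (n + 1), (k * B n j) • L (u j) := by
  rw [memoryTerm, sum_range_succ, sum_Ico_eq_sum_range]
  simp only [Nat.add_sub_cancel, map_sub, map_add, map_sum, map_smul, smul_sub, smul_add, smul_sum,
    smul_smul, sub_smul, add_comm 1]
  abel

/-- One step of the scheme, tested with `A^{-1/2} U_2`. -/
theorem scheme_step_inner {A S R : H →L[ℝ] H} (hS : ∀ x y : H, ⟪S x, y⟫ = ⟪x, S y⟫)
    (hSS : ∀ x, S (S x) = A x) (hSR : ∀ x, S (R x) = x) (hRS : ∀ x, R (S x) = x)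
    {ρ k : ℝ} {m d v v' g : H} (hd : d = k • v')
    (h : ρ • (v' - v) + k • A m = g) :
    ρ * ⟪R v', R v' - R v⟫ + ⟪m, d⟫ = ⟪R g, R v'⟫ := by
  rw [← h, hd, ← hSS]
  simp only [map_add, map_smul, map_sub, hRS, inner_add_left, real_inner_smul_left,
    real_inner_smul_right, hS, hSR]
  rw [real_inner_comm]

end Scheme

/-- Stability estimate for the dG(0) scheme (Theorem 4.1, case `l = −1`):
there is a constant `C` depending only on `γ` and `ρ` such that
`‖U_{1,N}‖ + ‖A^{−1/2} U_{2,N}‖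
   ≤ C (‖u_0‖ + ‖A^{−1/2} v_0‖ + ∫_0^T (‖f_1‖ + ‖A^{−1/2} f_2‖) dt)`.
Here `sqrtA` is the positive square root `A^{1/2}` of `A` and
`invSqrtA = A^{−1/2}` is its inverse. -/
theorem dG0_stability_weak.{u} (γ ρ : ℝ) (hγ0 : 0 < γ) (hγ1 : γ < 1) (hρ : 0 < ρ) :
    ∃ C : ℝ, 0 < C ∧
      ∀ (H : Type u) [NormedAddCommGroup H] [InnerProductSpace ℝ H] [CompleteSpace H],
      ∀ (N : ℕ), 1 ≤ N → ∀ (tp : ℕ → ℝ), tp 0 = 0 → (∀ n < N, tp n < tp (n + 1)) →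
      ∀ (β : ℝ → ℝ), (∀ s ∈ Set.Ioi (0:ℝ), 0 ≤ β s) → AntitoneOn β (Set.Ioi 0) →
        LocallyIntegrableOn β (Set.Ioi 0) → (∫ s in Set.Ioi (0:ℝ), β s) = γ →
      ∀ (A sqrtA invSqrtA : H →L[ℝ] H),
        (∀ x y : H, ⟪A x, y⟫ = ⟪x, A y⟫) →
        (∃ c > 0, ∀ x : H, c * ‖x‖ ^ 2 ≤ ⟪A x, x⟫) →
        (∀ x y : H, ⟪sqrtA x, y⟫ = ⟪x, sqrtA y⟫) →
        (∀ x : H, 0 ≤ ⟪sqrtA x, x⟫) →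
        (∀ x : H, sqrtA (sqrtA x) = A x) →
        (∀ x : H, sqrtA (invSqrtA x) = x) →
        (∀ x : H, invSqrtA (sqrtA x) = x) →
      ∀ (u0 v0 : H) (f1 f2 : ℝ → H),
        IntegrableOn f1 (Set.Icc 0 (tp N)) → IntegrableOn f2 (Set.Icc 0 (tp N)) →
      ∀ (U1 U2 : ℕ → H), U1 0 = u0 → U2 0 = v0 →
        (∀ n : ℕ, 1 ≤ n → n ≤ N →
          U1 n - U1 (n - 1) = kstep tp n • U2 n + kstep tp n • iavg tp f1 n) →
        (∀ n : ℕ, 1 ≤ n → n ≤ N →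
          ρ • (U2 n - U2 (n - 1)) + (kstep tp n - qweight β tp n n) • A (U1 n)
              - ∑ j ∈ Finset.Ico 1 n, qweight β tp n j • A (U1 j)
            = kstep tp n • iavg tp f2 n) →
      ‖U1 N‖ + ‖invSqrtA (U2 N)‖
        ≤ C * (‖u0‖ + ‖invSqrtA v0‖
            + ∫ t in (0:ℝ)..(tp N), (‖f1 t‖ + ‖invSqrtA (f2 t)‖)) := by
  refine ⟨stabilityConst γ ρ, stabilityConst_pos hγ1 hρ, ?_⟩
  intro H _ _ _ N _ tp htp0 htp β h0 hβ _ hint A S R _ _ hS _ hSS hSR hRS u0 v0 f1 f2 hf1 hf2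
    U1 U2 hu0 hv0 hU1 hU2
  have hi : IntegrableOn β (Set.Ioi 0) :=
    Integrable.of_integral_ne_zero (by rw [hint]; exact hγ0.ne')
  obtain ⟨τ, hτ, hτe⟩ := exists_strictMono_extension htp
  have hτ0 : τ 0 = 0 := (hτe 0 (Nat.zero_le N)).trans htp0
  have hq : ∀ n j, n ≤ N → j ≤ N → qweight β tp n j = qweight β τ n j := fun n j hn hj => by
    simp only [qweight, hτe n hn, hτe j hj, hτe (n - 1) (by omega), hτe (j - 1) (by omega)]
  have hstep : ∀ n < N, ρ * ⟪R (U2 (n + 1)), R (U2 (n + 1)) - R (U2 n)⟫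
      + ⟪memoryTerm (meanWeight β γ τ) U1 n,
          U1 (n + 1) - U1 n - ∫ t in (tp n)..(tp (n + 1)), f1 t⟫
      = ⟪R (∫ t in (tp n)..(tp (n + 1)), f2 t), R (U2 (n + 1))⟫ := by
    intro n hn
    have hk : kstep tp (n + 1) = τ (n + 1) - τ n := by
      rw [hτe n hn.le, hτe (n + 1) hn, kstep, Nat.add_sub_cancel]
    have hqm : ∀ j ≤ n + 1, 1 ≤ j →
        qweight β tp (n + 1) j = kstep tp (n + 1) * meanWeight β γ τ n j := by
      intro j hj h1
      obtain ⟨i, rfl⟩ := Nat.exists_eq_add_of_le' h1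
      rw [hq _ _ hn (hj.trans hn), hk]
      exact qweight_eq_meanWeight hi hτ (by omega)
    have e1 := hU1 (n + 1) (Nat.le_add_left 1 n) hn
    have e2 := hU2 (n + 1) (Nat.le_add_left 1 n) hn
    rw [kstep_smul_iavg (htp n hn), Nat.add_sub_cancel] at e1 e2
    refine scheme_step_inner (A := A) (k := kstep tp (n + 1)) hS hSS hSR hRS
      (sub_eq_of_eq_add e1) ?_
    rw [smul_map_memoryTerm, ← e2, hqm (n + 1) le_rfl (Nat.le_add_left 1 n), add_sub_assoc]
    congr 2
    refine sum_congr rfl fun j hj => ?_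
    have hj := mem_Ico.1 hj
    rw [hqm j hj.2.le hj.1]
  have hmain := norm_add_norm_le_stabilityConst (w := fun n => R (U2 n))
    (fun n j => meanWeight_nonneg h0 hi hint hτ.monotone n j)
    (fun n j hj => meanWeight_succ_le h0 hβ hi hτ hj) hγ0.le hγ1 hρ (sum_meanWeight hi hτ0 hτ) hstep
  have hsub : ∀ n < N, Set.uIcc (tp n) (tp (n + 1)) ⊆ Set.Icc 0 (tp N) := fun n hn => by
    rw [Set.uIcc_of_le (htp n hn).le, ← htp0, ← hτe 0 (Nat.zero_le N), ← hτe n hn.le,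
      ← hτe (n + 1) hn, ← hτe N le_rfl]
    exact Set.Icc_subset_Icc (hτ.monotone (Nat.zero_le n)) (hτ.monotone hn)
  have hI1 : ∀ n < N, IntervalIntegrable f1 volume (tp n) (tp (n + 1)) :=
    fun n hn => (hf1.mono_set (hsub n hn)).intervalIntegrable
  have hI2 : ∀ n < N, IntervalIntegrable f2 volume (tp n) (tp (n + 1)) :=
    fun n hn => (hf2.mono_set (hsub n hn)).intervalIntegrable
  have hR2 : ∀ n < N, IntervalIntegrable (fun t => R (f2 t)) volume (tp n) (tp (n + 1)) :=
    fun n hn => IntegrableOn.intervalIntegrable (R.integrable_comp (hf2.mono_set (hsub n hn)))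
  have hdata := sum_norm_integral_le htp0 htp hI1 hR2
  rw [sum_congr rfl fun n hn => by
    rw [R.intervalIntegral_comp_comm (hI2 n (mem_range.1 hn))]] at hdata
  rw [← hu0, ← hv0]
  exact hmain.trans (mul_le_mul_of_nonneg_left (by gcongr) (stabilityConst_pos hγ1 hρ).le)
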